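/- Let Q₁, Q₂, Q₃ be rank-one orthogonal projections in M₃(ℂ) with Q₁ + Q₂ + Q₃ = I. Then the subalgebra 𝒜 := Q₁·M₃(ℂ)·(Q₂+Q₃) + Q₂·M₃(ℂ)·Q₃ + ℂI = {Q₁S(Q₂+Q₃) + Q₂TQ₃ + αI : S, T ∈ M₃(ℂ), α ∈ ℂ} is idempotent compressible. -/

import Mathlib

open Matrix

abbrev Mat (n : ℕ) := Matrix (Fin n) (Fin n) ℂ

/-- A set of matrices is closed under multiplication. -/
def MulClosed {n : ℕ} (S : Set (Mat n)) : Prop :=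
  ∀ x ∈ S, ∀ y ∈ S, x * y ∈ S

/-- The compression `E 𝒜 E = {E A E : A ∈ 𝒜}` of a set of matrices by `E`. -/
def compress {n : ℕ} (E : Mat n) (A : Set (Mat n)) : Set (Mat n) :=
  (fun M => E * M * E) '' A

/-- `𝒜` is projection compressible: for every orthogonal projection `P`,
`P 𝒜 P` is closed under multiplication. -/
def ProjectionCompressible {n : ℕ} (A : Set (Mat n)) : Prop :=
  ∀ P : Mat n, P * P = P → Pᴴ = P → MulClosed (compress P A)

/-- `𝒜` is idempotent compressible: for every idempotent `E`,
`E 𝒜 E` is closed under multiplication. -/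
def IdempotentCompressible {n : ℕ} (A : Set (Mat n)) : Prop :=
  ∀ E : Mat n, E * E = E → MulClosed (compress E A)

/-- Three idempotents summing to `1` in an algebra over `ℚ` are mutually orthogonal. -/
theorem mul_eq_zero_of_idempotent_sum {R : Type*} [Ring R] [Algebra ℚ R] {p q r : R}
    (hp : p * p = p) (hq : q * q = q) (hr : r * r = r) (hsum : p + q + r = 1) : p * q = 0 := by
  have hanti : p * q + q * p = 0 := by
    have h : (1 - (p + q)) * (1 - (p + q)) = 1 - (p + q) := by
      rwa [← hsum, add_sub_cancel_left]
    have h' : (1 - (p + q)) * (1 - (p + q)) - (1 - (p + q))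
        = p * p - p + (q * q - q) + (p * q + q * p) := by noncomm_ring
    rw [h, hp, hq] at h'
    simpa using h'.symm
  have hneg : p * q = -(q * p) := eq_neg_of_add_eq_zero_left hanti
  have hcomm : p * q = q * p := by
    calc p * q = p * (p * q) := by rw [← mul_assoc, hp]
      _ = -(p * q * p) := by rw [hneg, mul_neg, ← mul_assoc, hneg]
      _ = q * p := by rw [hneg, neg_mul, neg_neg, mul_assoc, hp]
  have : IsAddTorsionFree R := IsAddTorsionFree.of_module_rat R
  rw [← hcomm] at hanti
  exact self_eq_neg.mp (eq_neg_of_add_eq_zero_left hanti)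

/-- A matrix of rank one is an outer product. -/
theorem exists_eq_vecMulVec_of_rank_eq_one {n : ℕ} {Q : Mat n} (hr : Q.rank = 1) :
    ∃ a b : Fin n → ℂ, Q = vecMulVec a b := by
  rw [Matrix.rank, finrank_eq_one_iff'] at hr
  obtain ⟨a, -, ha⟩ := hr
  have hcol : ∀ j, ∃ c : ℂ, c • (a : Fin n → ℂ) = Q *ᵥ Pi.single j 1 := fun j => by
    obtain ⟨c, hc⟩ := ha ⟨Q *ᵥ Pi.single j 1, ⟨Pi.single j 1, rfl⟩⟩
    exact ⟨c, congrArg Subtype.val hc⟩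
  choose b hb using hcol
  refine ⟨a, b, ?_⟩
  ext i j
  have h := congrFun (hb j) i
  simp only [mulVec_single_one, Pi.smul_apply, smul_eq_mul, col_apply] at h
  rw [vecMulVec_apply, ← h, mul_comm]

theorem vecMulVec_mul_mul_vecMulVec {n : ℕ} (a b c d : Fin n → ℂ) (M : Mat n) :
    vecMulVec a b * M * vecMulVec c d = (b ⬝ᵥ M *ᵥ c) • vecMulVec a d := by
  rw [mul_assoc, mul_vecMulVec, vecMulVec_mul_vecMulVec, vecMulVec_smul]

theorem exists_mul_mul_eq_smul_of_rank_eq_one {n : ℕ} {Q : Mat n} (hr : Q.rank = 1) (M : Mat n) :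
    ∃ c : ℂ, Q * M * Q = c • Q := by
  obtain ⟨a, b, rfl⟩ := exists_eq_vecMulVec_of_rank_eq_one hr
  exact ⟨_, vecMulVec_mul_mul_vecMulVec a b a b M⟩

/-- For rank-one idempotents `P`, `Q`, a nonzero corner `Q M P` is invertible as a map from the
range of `P` to the range of `Q`. -/
theorem exists_corner_inverse {n : ℕ} {P Q M : Mat n} (hP : P * P = P) (hQ : Q * Q = Q)
    (hPr : P.rank = 1) (hQr : Q.rank = 1) (hM : Q * M * P ≠ 0) :
    ∃ Z : Mat n, P * Z = Z ∧ Z * Q = Z ∧ Q * M * Z = Q ∧ Z * M * P = P := by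
  obtain ⟨a, b, rfl⟩ := exists_eq_vecMulVec_of_rank_eq_one hPr
  obtain ⟨c, d, rfl⟩ := exists_eq_vecMulVec_of_rank_eq_one hQr
  rw [vecMulVec_mul_mul_vecMulVec] at hM
  have hs : d ⬝ᵥ M *ᵥ a ≠ 0 := fun h => hM (by rw [h, zero_smul])
  have hba : vecMulVec a b ≠ 0 := fun h => by simp [h] at hPr
  have hdc : vecMulVec c d ≠ 0 := fun h => by simp [h] at hQr
  have hba1 : b ⬝ᵥ a = 1 := by
    rw [vecMulVec_mul_vecMulVec, vecMulVec_smul] at hP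
    exact smul_left_injective ℂ hba (by simpa using hP)
  have hdc1 : d ⬝ᵥ c = 1 := by
    rw [vecMulVec_mul_vecMulVec, vecMulVec_smul] at hQ
    exact smul_left_injective ℂ hdc (by simpa using hQ)
  refine ⟨(d ⬝ᵥ M *ᵥ a)⁻¹ • vecMulVec a d, ?_, ?_, ?_, ?_⟩
  · rw [mul_smul_comm, vecMulVec_mul_vecMulVec, hba1, one_smul]
  · rw [smul_mul_assoc, vecMulVec_mul_vecMulVec, hdc1, one_smul]
  · rw [mul_smul_comm, vecMulVec_mul_mul_vecMulVec, inv_smul_smul₀ hs]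
  · rw [smul_mul_assoc, smul_mul_assoc, vecMulVec_mul_mul_vecMulVec, inv_smul_smul₀ hs]

/-- Example 3.2.8: if `Q₁, Q₂, Q₃` are rank-one orthogonal projections in `M₃(ℂ)`
summing to `I`, then `Q₁ M₃(ℂ) (Q₂+Q₃) + Q₂ M₃(ℂ) Q₃ + ℂI` is idempotent compressible. -/
theorem example_3_2_8 (Q₁ Q₂ Q₃ : Mat 3)
    (hQ₁ : Q₁ * Q₁ = Q₁) (hQ₁' : Q₁ᴴ = Q₁) (hQ₁r : Q₁.rank = 1)
    (hQ₂ : Q₂ * Q₂ = Q₂) (hQ₂' : Q₂ᴴ = Q₂) (hQ₂r : Q₂.rank = 1)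
    (hQ₃ : Q₃ * Q₃ = Q₃) (hQ₃' : Q₃ᴴ = Q₃) (hQ₃r : Q₃.rank = 1)
    (hsum : Q₁ + Q₂ + Q₃ = 1) :
    IdempotentCompressible
      {M : Mat 3 | ∃ (S T : Mat 3) (α : ℂ),
        M = Q₁ * S * (Q₂ + Q₃) + Q₂ * T * Q₃ + α • (1 : Mat 3)} := by
  have h12 := mul_eq_zero_of_idempotent_sum hQ₁ hQ₂ hQ₃ hsum
  have h21 := mul_eq_zero_of_idempotent_sum hQ₂ hQ₁ hQ₃ (by rw [← hsum]; abel)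
  have h13 := mul_eq_zero_of_idempotent_sum hQ₁ hQ₃ hQ₂ (by rw [← hsum]; abel)
  have h31 := mul_eq_zero_of_idempotent_sum hQ₃ hQ₁ hQ₂ (by rw [← hsum]; abel)
  have h23 := mul_eq_zero_of_idempotent_sum hQ₂ hQ₃ hQ₁ (by rw [← hsum]; abel)
  have h32 := mul_eq_zero_of_idempotent_sum hQ₃ hQ₂ hQ₁ (by rw [← hsum]; abel)
  have hstrict : ∀ S T : Mat 3, ∃ N : Mat 3, N = Q₁ * S * (Q₂ + Q₃) + Q₂ * T * Q₃ ∧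
      N * Q₁ = 0 ∧ Q₃ * N = 0 ∧ Q₂ * N = Q₂ * N * Q₃ ∧ N * Q₂ = Q₁ * N * Q₂ := by
    intro S T
    refine ⟨_, rfl, ?_, ?_, ?_, ?_⟩
    · simp only [add_mul, mul_assoc, h21, h31, mul_zero, add_zero]
    · simp only [mul_add, ← mul_assoc, h31, h32, zero_mul, add_zero]
    · simp only [mul_add, ← mul_assoc, h21, hQ₂, zero_mul, zero_add]
      rw [mul_assoc _ Q₃, hQ₃]
    · simp only [mul_add, add_mul, ← mul_assoc, hQ₁, h12, zero_mul, add_zero]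
      simp only [mul_assoc _ Q₃ Q₂, h32, mul_zero, add_zero]
  have hmem : ∀ (N : Mat 3) (α : ℂ), N * Q₁ = 0 → Q₃ * N = 0 → Q₂ * N * Q₂ = 0 →
      ∃ (S T : Mat 3) (β : ℂ),
        N + α • (1 : Mat 3) = Q₁ * S * (Q₂ + Q₃) + Q₂ * T * Q₃ + β • (1 : Mat 3) := by
    intro N α h1 h3 h2
    refine ⟨N, N, α, congrArg (· + α • (1 : Mat 3)) ?_⟩
    calc N = (Q₁ + Q₂ + Q₃) * N * (Q₁ + Q₂ + Q₃) := by rw [hsum, one_mul, mul_one]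
      _ = Q₁ * N * (Q₂ + Q₃) + Q₂ * N * Q₃
          + ((Q₁ + Q₂) * (N * Q₁) + Q₂ * N * Q₂ + Q₃ * N * (Q₁ + Q₂ + Q₃)) := by noncomm_ring
      _ = Q₁ * N * (Q₂ + Q₃) + Q₂ * N * Q₃ := by rw [h1, h2, h3]; simp
  rintro E hE _ ⟨_, ⟨S, T, α, rfl⟩, rfl⟩ _ ⟨_, ⟨S', T', β, rfl⟩, rfl⟩
  obtain ⟨N, hN, hN1, hN3, hN2L, -⟩ := hstrict S T
  obtain ⟨N', hN', hN1', hN3', hN2L', hN2R'⟩ := hstrict S' T'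
  rw [← hN, ← hN']
  have hcorner : Q₂ * (N * E * N') * Q₂ = Q₂ * N * (Q₃ * E * Q₁) * (N' * Q₂) := by
    calc Q₂ * (N * E * N') * Q₂ = (Q₂ * N) * E * (N' * Q₂) := by noncomm_ring
      _ = (Q₂ * N * Q₃) * E * (Q₁ * N' * Q₂) := by rw [← hN2L, ← hN2R']
      _ = _ := by noncomm_ring
  obtain ⟨c, Z, hc, hZ1, hZ3, hEZ, hZE⟩ : ∃ (c : ℂ) (Z : Mat 3),
      Q₂ * (N * E * N') * Q₂ = c • Q₂ ∧ Q₁ * Z = Z ∧ Z * Q₃ = Z ∧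
        Q₃ * E * Z = c • Q₃ ∧ Z * E * Q₁ = c • Q₁ := by
    by_cases h : Q₃ * E * Q₁ = 0
    · exact ⟨0, 0, by rw [hcorner, h]; simp, by simp, by simp, by simp, by simp⟩
    · obtain ⟨c, hc⟩ := exists_mul_mul_eq_smul_of_rank_eq_one hQ₂r (N * E * N')
      obtain ⟨Z, hZ1, hZ3, hEZ, hZE⟩ := exists_corner_inverse hQ₁ hQ₃ hQ₁r hQ₃r h
      refine ⟨c, c • Z, hc, ?_, ?_, ?_, ?_⟩
      · rw [mul_smul_comm, hZ1]
      · rw [smul_mul_assoc, hZ3]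
      · rw [mul_smul_comm, hEZ]
      · rw [smul_mul_assoc, smul_mul_assoc, hZE]
  have hZQ1 : Z * Q₁ = 0 := by rw [← hZ3, mul_assoc, h31, mul_zero]
  have hZQ2 : Z * Q₂ = 0 := by rw [← hZ3, mul_assoc, h32, mul_zero]
  have hQ2Z : Q₂ * Z = 0 := by rw [← hZ1, ← mul_assoc, h21, zero_mul]
  have hQ3Z : Q₃ * Z = 0 := by rw [← hZ1, ← mul_assoc, h31, zero_mul]
  have hNQ2 : Q₂ * N * Q₂ = 0 := by rw [hN2L, mul_assoc, h32, mul_zero]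
  have hNQ2' : Q₂ * N' * Q₂ = 0 := by rw [hN2L', mul_assoc, h32, mul_zero]
  refine ⟨(N * E * N' + ((E - 1) * Z + Z * (E - 1)) - c • 1 + α • N' + β • N)
    + (α * β + c) • 1, hmem _ _ ?_ ?_ ?_, ?_⟩
  · calc _ = N * E * (N' * Q₁) + (E - 1) * (Z * Q₁) + (Z * E * Q₁ - Z * Q₁) - c • Q₁
          + α • (N' * Q₁) + β • (N * Q₁) := by
            simp only [add_mul, sub_mul, mul_sub, smul_mul_assoc, one_mul, mul_one, mul_assoc]
            abel
      _ = 0 := by rw [hN1, hN1', hZQ1, hZE]; simp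
  · calc _ = (Q₃ * N) * E * N' + (Q₃ * E * Z - Q₃ * Z) + (Q₃ * Z) * (E - 1) - c • Q₃
          + α • (Q₃ * N') + β • (Q₃ * N) := by
            simp only [mul_add, sub_mul, mul_sub, mul_smul_comm, one_mul, mul_one, ← mul_assoc]
            abel
      _ = 0 := by rw [hN3, hN3', hQ3Z, hEZ]; simp
  · calc _ = Q₂ * (N * E * N') * Q₂ + Q₂ * (E - 1) * (Z * Q₂) + (Q₂ * Z) * (E - 1) * Q₂
          - c • (Q₂ * Q₂) + α • (Q₂ * N' * Q₂) + β • (Q₂ * N * Q₂) := by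
            simp only [mul_add, add_mul, sub_mul, mul_sub, mul_smul_comm, smul_mul_assoc, one_mul,
              mul_one, mul_assoc]
            abel
      _ = 0 := by rw [hc, hQ₂, hNQ2, hNQ2', hZQ2, hQ2Z]; simp
  · have hE0 : E * (E - 1) = 0 := by rw [mul_sub, hE, mul_one, sub_self]
    have hE0' : (E - 1) * E = 0 := by rw [sub_mul, hE, one_mul, sub_self]
    have hZ0 : E * ((E - 1) * Z + Z * (E - 1)) * E = 0 := by
      calc _ = E * (E - 1) * Z * E + E * Z * ((E - 1) * E) := by noncomm_ring
        _ = 0 := by rw [hE0, hE0']; simp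
    calc _ = E * (N * E * N') * E + E * ((E - 1) * Z + Z * (E - 1)) * E + α • (E * N' * E)
          + β • (E * N * E) + (α * β) • (E * E) := by
            simp only [mul_add, add_mul _ _ E, sub_mul _ _ E, mul_sub E, mul_smul_comm,
              smul_mul_assoc, mul_one, add_smul]
            abel
      _ = E * (N + α • 1) * (E * E) * (N' + β • 1) * E := by
            rw [hZ0, hE]
            simp only [mul_add, add_mul, mul_smul_comm, smul_mul_assoc, mul_one, mul_assoc, hE,
              smul_add, smul_smul, add_zero, mul_comm β α]
            simp only [← mul_assoc]
            abel
      _ = _ := by simp only [mul_assoc]
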